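/- arXiv:1708.06009 — 10 statements merged into one kernel-verified Lean document; each statement's English description precedes it below -/
import Mathlib

section
/- Let p be an odd prime and q = (p−1)/2. The subgroup S = {(α₀, …, α_{p−1}) ∈ (ℤ^{1+q})^p : |α₀| = |α₁| = ⋯ = |α_{p−1}|} of p-tuples of equal dimension is a free abelian group of rank p(p−1)/2 + 1, and the family consisting of the element 𝟙 together with the p·q elements Ω_{i,j} for 0 ≤ i ≤ p−1 and 1 ≤ j ≤ q is a ℤ-basis of S. -/
/-- The dimension of an element of `RO(ℤ/p)`, modeled additively as `ℤ^{1+q}`: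
`α = (n₀, n₁, …, n_q)` has `|α| = n₀ + 2(n₁ + ⋯ + n_q)`. -/
def dimRO (q : ℕ) (α : Fin (q + 1) → ℤ) : ℤ := α 0 + 2 * ∑ j : Fin q, α j.succ

/-- The element `M_j − 2` of `RO(ℤ/p)`. -/
def MMinusTwo (q : ℕ) (j : Fin q) : Fin (q + 1) → ℤ :=
  fun r => if r = 0 then -2 else if r = j.succ then 1 else 0

/-- The element `Ω_{i,j}` of `RO(Π_G B)`: the tuple whose `i`-th component is `M_j − 2`
and whose other components are `0`. -/
def OmegaP (p q : ℕ) (i : Fin p) (j : Fin q) : Fin p → Fin (q + 1) → ℤ :=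
  fun k => if k = i then MMinusTwo q j else 0

/-- The element `𝟙` of `RO(Π_G B)`: the constant tuple with every component `(1,0,…,0)`. -/
def oneP (p q : ℕ) : Fin p → Fin (q + 1) → ℤ :=
  fun _ r => if r = 0 then 1 else 0

/-- The family consisting of `𝟙` together with the `Ω_{i,j}`. -/
def famP (p q : ℕ) : Option (Fin p × Fin q) → (Fin p → Fin (q + 1) → ℤ)
  | none => oneP p q
  | some ⟨i, j⟩ => OmegaP p q i j

theorem sum_smul_famP_zero (p q : ℕ) (c : Option (Fin p × Fin q) → ℤ) (k : Fin p) :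
    (∑ a, c a • famP p q a) k 0 = c none - 2 * ∑ j : Fin q, c (some (k, j)) := by
  simp [Fintype.sum_option, Fintype.sum_prod_type_right, Finset.sum_apply, famP, oneP, OmegaP,
    ite_apply, MMinusTwo, ← Finset.sum_mul]
  ring

theorem sum_smul_famP_succ (p q : ℕ) (c : Option (Fin p × Fin q) → ℤ) (k : Fin p) (j : Fin q) :
    (∑ a, c a • famP p q a) k j.succ = c (some (k, j)) := by
  simp [Fintype.sum_option, Fintype.sum_prod_type, Finset.sum_apply, famP, oneP, OmegaP,
    ite_apply, MMinusTwo]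

theorem dimRO_sum_smul_famP (p q : ℕ) (c : Option (Fin p × Fin q) → ℤ) (k : Fin p) :
    dimRO q ((∑ a, c a • famP p q a) k) = c none := by
  simp only [dimRO, sum_smul_famP_zero, sum_smul_famP_succ]
  ring

theorem linearIndependent_famP {p : ℕ} (hp : 0 < p) (q : ℕ) :
    LinearIndependent ℤ (famP p q) := by
  rw [Fintype.linearIndependent_iff]
  rintro c hc (_ | ⟨k, j⟩)
  · rw [← dimRO_sum_smul_famP p q c ⟨0, hp⟩, hc]
    simp [dimRO]
  · rw [← sum_smul_famP_succ p q c k j, hc]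
    rfl

theorem coe_span_range_famP {p : ℕ} (hp : 0 < p) (q : ℕ) :
    (Submodule.span ℤ (Set.range (famP p q)) : Set (Fin p → Fin (q + 1) → ℤ)) =
      {x | ∀ k l, dimRO q (x k) = dimRO q (x l)} := by
  ext x
  rw [SetLike.mem_coe, Submodule.mem_span_range_iff_exists_fun, Set.mem_ofPred_eq]
  constructor
  · rintro ⟨c, rfl⟩ k l
    rw [dimRO_sum_smul_famP, dimRO_sum_smul_famP]
  · intro hx
    refine ⟨fun a => a.elim (dimRO q (x ⟨0, hp⟩)) fun a => x a.1 a.2.succ, ?_⟩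
    ext k r
    refine Fin.cases ?_ (fun j => ?_) r
    · rw [sum_smul_famP_zero]
      simp only [Option.elim]
      rw [hx ⟨0, hp⟩ k, dimRO, add_sub_cancel_right]
    · rw [sum_smul_famP_succ]
      rfl

/-- For an odd prime `p` and `q = (p−1)/2`, the subgroup
`S = {(α₀, …, α_{p−1}) : |α₀| = ⋯ = |α_{p−1}|}` of `(ℤ^{1+q})^p` is a free abelian group
of rank `p(p−1)/2 + 1`, with basis `𝟙` together with the `Ω_{i,j}` for `0 ≤ i ≤ p−1`,
`1 ≤ j ≤ q`. -/
theorem stmt0 (p : ℕ) (hp : p.Prime) (hodd : Odd p) (q : ℕ) (hq : q = (p - 1) / 2) :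
    LinearIndependent ℤ (famP p q) ∧
    (Submodule.span ℤ (Set.range (famP p q)) : Set (Fin p → Fin (q + 1) → ℤ)) =
      {x | ∀ k l, dimRO q (x k) = dimRO q (x l)} ∧
    Nat.card (Option (Fin p × Fin q)) = p * (p - 1) / 2 + 1 := by
  refine ⟨linearIndependent_famP hp.pos q, coe_span_range_famP hp.pos q, ?_⟩
  obtain ⟨m, rfl⟩ := hodd
  have h : 2 * m + 1 - 1 = 2 * m := by omega
  rw [hq, h, Nat.mul_div_assoc _ (Dvd.intro m rfl)]
  simp
end

section
/- Let p be an odd prime, q = (p−1)/2, and 0 ≤ k ≤ p−1. The kernel of the projection S → ℤ^{1+q} sending (α₀, …, α_{p−1}) to α_k is exactly the subgroup of S generated by the elements Ω_{i,j} with i ≠ k and 1 ≤ j ≤ q; moreover these (p−1)·q elements are ℤ-linearly independent, so this kernel is a free abelian group with the Ω_{i,j} (i ≠ k) as a basis. -/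
theorem dimRO_zero (q : ℕ) : dimRO q 0 = 0 := by simp [dimRO]

theorem dimRO_add (q : ℕ) (α β : Fin (q + 1) → ℤ) :
    dimRO q (α + β) = dimRO q α + dimRO q β := by
  simp only [dimRO, Pi.add_apply, Finset.sum_add_distrib]
  ring

theorem dimRO_smul (q : ℕ) (c : ℤ) (α : Fin (q + 1) → ℤ) :
    dimRO q (c • α) = c * dimRO q α := by
  simp only [dimRO, Pi.smul_apply, smul_eq_mul, ← Finset.mul_sum]
  ring

theorem MMinusTwo_succ (q : ℕ) (j r : Fin q) :
    MMinusTwo q j r.succ = if r = j then 1 else 0 := by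
  simp [MMinusTwo, Fin.succ_ne_zero]

theorem dimRO_MMinusTwo (q : ℕ) (j : Fin q) : dimRO q (MMinusTwo q j) = 0 := by
  simp only [dimRO, MMinusTwo_succ]
  simp [MMinusTwo]

/-- An element of `RO(ℤ/p)` is determined by its dimension and its coordinates at the
nontrivial irreducible representations. -/
theorem eq_of_dimRO_eq {q : ℕ} {α β : Fin (q + 1) → ℤ} (hdim : dimRO q α = dimRO q β)
    (hsucc : ∀ j : Fin q, α j.succ = β j.succ) : α = β := by
  ext r
  refine Fin.cases ?_ hsucc r
  simpa [dimRO, hsucc] using hdim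

theorem sum_smul_OmegaP_apply_succ {p q : ℕ} {k : Fin p}
    (c : {i : Fin p // i ≠ k} × Fin q → ℤ) (i : {i : Fin p // i ≠ k}) (j : Fin q) :
    (∑ ij, c ij • OmegaP p q ij.1.1 ij.2) i.1 j.succ = c (i, j) := by
  rw [Finset.sum_apply, Finset.sum_apply, Finset.sum_eq_single (i, j)]
  · simp [OmegaP, MMinusTwo_succ]
  · rintro ⟨a, b⟩ - hab
    by_cases ha : i.1 = a.1
    · have hb : j ≠ b := fun hb => hab (Prod.ext (Subtype.ext ha.symm) hb.symm)
      simp [OmegaP, MMinusTwo_succ, ha, hb]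
    · simp [OmegaP, ha]
  · simp

theorem dimRO_eq_zero_of_mem_span_OmegaP {p q : ℕ} {k : Fin p} {x : Fin p → Fin (q + 1) → ℤ}
    (hx : x ∈ Submodule.span ℤ
      (Set.range (fun ij : {i : Fin p // i ≠ k} × Fin q => OmegaP p q ij.1.1 ij.2))) :
    (∀ a, dimRO q (x a) = 0) ∧ x k = 0 := by
  induction hx using Submodule.span_induction with
  | mem x hx =>
    obtain ⟨⟨i, j⟩, rfl⟩ := hx
    refine ⟨fun a => ?_, by simp [OmegaP, i.2.symm]⟩
    by_cases ha : a = i.1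
    · simp [OmegaP, ha, dimRO_MMinusTwo]
    · simp [OmegaP, ha, dimRO_zero]
  | zero => exact ⟨fun _ => dimRO_zero q, rfl⟩
  | add x y _ _ hx hy =>
    exact ⟨fun a => by simp [dimRO_add, hx.1, hy.1], by simp [hx.2, hy.2]⟩
  | smul c x _ hx =>
    exact ⟨fun a => by simp only [Pi.smul_apply, dimRO_smul, hx.1, mul_zero], by simp [hx.2]⟩

/-- For an odd prime `p`, `q = (p−1)/2` and `0 ≤ k ≤ p−1`: the kernel of the projection
`S → ℤ^{1+q}`, `(α₀, …, α_{p−1}) ↦ α_k`, is exactly the subgroup of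
`S = {x : all components have equal dimension}` generated by the `Ω_{i,j}` with `i ≠ k`;
moreover these `(p−1)·q` elements are ℤ-linearly independent, so the kernel is free
abelian with them as a basis. -/
theorem stmt2 (p : ℕ) (hp : p.Prime) (hodd : Odd p) (q : ℕ) (hq : q = (p - 1) / 2)
    (k : Fin p) :
    LinearIndependent ℤ
      (fun ij : {i : Fin p // i ≠ k} × Fin q => OmegaP p q ij.1.1 ij.2) ∧
    (Submodule.span ℤ
        (Set.range (fun ij : {i : Fin p // i ≠ k} × Fin q => OmegaP p q ij.1.1 ij.2)) :
        Set (Fin p → Fin (q + 1) → ℤ)) =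
      {x | (∀ a b, dimRO q (x a) = dimRO q (x b)) ∧ x k = 0} := by
  refine ⟨Fintype.linearIndependent_iff.2 fun c hc ij => ?_, Set.Subset.antisymm ?_ ?_⟩
  · rw [← sum_smul_OmegaP_apply_succ c ij.1 ij.2, hc]
    rfl
  · intro x hx
    obtain ⟨hdim, hk⟩ := dimRO_eq_zero_of_mem_span_OmegaP hx
    exact ⟨fun a b => by rw [hdim a, hdim b], hk⟩
  · rintro x ⟨hdim, hk⟩
    let c : {i : Fin p // i ≠ k} × Fin q → ℤ := fun ij => x ij.1.1 ij.2.succ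
    have hmem : ∑ ij, c ij • OmegaP p q ij.1.1 ij.2 ∈ Submodule.span ℤ
        (Set.range (fun ij : {i : Fin p // i ≠ k} × Fin q => OmegaP p q ij.1.1 ij.2)) :=
      Submodule.sum_mem _ fun ij _ =>
        Submodule.smul_mem _ _ (Submodule.subset_span (Set.mem_range_self ij))
    obtain ⟨hdim', hk'⟩ := dimRO_eq_zero_of_mem_span_OmegaP hmem
    suffices h : x = ∑ ij, c ij • OmegaP p q ij.1.1 ij.2 by rw [h]; exact hmem
    funext a
    by_cases ha : a = k
    · rw [ha, hk, hk']
    · refine eq_of_dimRO_eq ?_ fun j => (sum_smul_OmegaP_apply_succ c ⟨a, ha⟩ j).symm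
      rw [hdim a k, hk, hdim', dimRO_zero]
end

section
/- Let p be a prime. Every short exact sequence 0 → ⟨ℤ⟩ → T → Rℤ → 0 of (ℤ/p)-Mackey functors is equivalent either to the split extension 0 → ⟨ℤ⟩ → ⟨ℤ⟩ ⊕ Rℤ → Rℤ → 0 or to the standard extension E_d for some d ∈ ℤ with p ∤ d. In particular the middle term T is isomorphic as a Mackey functor either to ⟨ℤ⟩ ⊕ Rℤ or to A[d] for some d with p ∤ d. -/
/-- A `(ℤ/p)`-Mackey functor on fixed carrier groups `M0` (level `G/G`) and `M1`
(level `G/e`): restriction `res`, transfer `tr` and conjugation `conj` satisfying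
`conj^p = id`, `conj ∘ res = res`, `tr ∘ conj = tr` and `res ∘ tr = Σ_{i<p} conjⁱ`. -/
structure Mackey (p : ℕ) (M0 M1 : Type) [AddCommGroup M0] [AddCommGroup M1] : Type where
  res : M0 →+ M1
  tr : M1 →+ M0
  conj : M1 →+ M1
  conj_pow : ∀ x : M1, (⇑conj)^[p] x = x
  conj_res : ∀ x : M0, conj (res x) = res x
  tr_conj : ∀ x : M1, tr (conj x) = tr x
  res_tr : ∀ x : M1, res (tr x) = ∑ i ∈ Finset.range p, (⇑conj)^[i] x

/-- A morphism of `(ℤ/p)`-Mackey functors: a pair of group homomorphisms commuting with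
restriction, transfer and conjugation. -/
structure MackeyHom {p : ℕ} {M0 M1 N0 N1 : Type} [AddCommGroup M0] [AddCommGroup M1]
    [AddCommGroup N0] [AddCommGroup N1] (S : Mackey p M0 M1) (T : Mackey p N0 N1) :
    Type where
  f0 : M0 →+ N0
  f1 : M1 →+ N1
  comm_res : ∀ x, f1 (S.res x) = T.res (f0 x)
  comm_tr : ∀ x, f0 (S.tr x) = T.tr (f1 x)
  comm_conj : ∀ x, f1 (S.conj x) = T.conj (f1 x)

/-- The Mackey functor `⟨ℤ⟩`: `ℤ` at level `G/G`, `0` at level `G/e`. -/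
def concZ (p : ℕ) : Mackey p ℤ PUnit where
  res := 0
  tr := 0
  conj := AddMonoidHom.id PUnit
  conj_pow := fun _ => Subsingleton.elim _ _
  conj_res := fun _ => Subsingleton.elim _ _
  tr_conj := fun _ => by simp
  res_tr := fun _ => Subsingleton.elim _ _

/-- The Mackey functor `Rℤ`: `ℤ` at both levels, `res = id`, `tr = ·p`, `t = id`. -/
def RZ (p : ℕ) : Mackey p ℤ ℤ where
  res := AddMonoidHom.id ℤ
  tr := AddMonoidHom.mk' (fun x : ℤ => (p : ℤ) * x) (fun a b => by ring)
  conj := AddMonoidHom.id ℤ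
  conj_pow := fun x => Function.iterate_fixed rfl p
  conj_res := fun _ => rfl
  tr_conj := fun _ => rfl
  res_tr := fun x => by
    have h : ∀ i : ℕ, (⇑(AddMonoidHom.id ℤ))^[i] x = x := fun i => Function.iterate_fixed rfl i
    simp [h, Finset.sum_const, nsmul_eq_mul]

/-- The Mackey functor `A[d]`: `ℤ ⊕ ℤ` at level `G/G`, `ℤ` at level `G/e`,
`res (a,b) = d·a + p·b`, `tr c = (0, c)`, `t = id`. -/
def AM (p : ℕ) (d : ℤ) : Mackey p (ℤ × ℤ) ℤ where
  res := AddMonoidHom.mk' (fun x : ℤ × ℤ => d * x.1 + (p : ℤ) * x.2)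
    (fun a b => by simp only [Prod.fst_add, Prod.snd_add]; ring)
  tr := AddMonoidHom.mk' (fun c : ℤ => ((0 : ℤ), c)) (fun a b => by simp [Prod.ext_iff])
  conj := AddMonoidHom.id ℤ
  conj_pow := fun x => Function.iterate_fixed rfl p
  conj_res := fun _ => rfl
  tr_conj := fun _ => rfl
  res_tr := fun x => by
    have h : ∀ i : ℕ, (⇑(AddMonoidHom.id ℤ))^[i] x = x := fun i => Function.iterate_fixed rfl i
    simp [h, Finset.sum_const, nsmul_eq_mul]

/-- The levelwise direct sum `⟨ℤ⟩ ⊕ Rℤ`, with componentwise structure maps. -/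
def SplitM (p : ℕ) : Mackey p (ℤ × ℤ) (PUnit × ℤ) where
  res := AddMonoidHom.mk' (fun x : ℤ × ℤ => (PUnit.unit, x.2))
    (fun a b => by simp [Prod.ext_iff])
  tr := AddMonoidHom.mk' (fun y : PUnit × ℤ => ((0 : ℤ), (p : ℤ) * y.2))
    (fun a b => by simp [Prod.ext_iff, mul_add])
  conj := AddMonoidHom.id (PUnit × ℤ)
  conj_pow := fun x => Function.iterate_fixed rfl p
  conj_res := fun _ => rfl
  tr_conj := fun _ => rfl
  res_tr := fun y => by
    have h : ∀ i : ℕ, (⇑(AddMonoidHom.id (PUnit × ℤ)))^[i] y = y :=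
      fun i => Function.iterate_fixed rfl i
    simp [h, Finset.sum_const, Prod.ext_iff, nsmul_eq_mul]

/-- Short five lemma for extensions by a fixed kernel, in element form: a homomorphism `h`
between extensions compatible with the inclusions `j`, `i` and the quotients `r`, `q` is bijective. -/
theorem bijective_of_extension_map {K M N Q : Type*} [AddCommGroup K] [AddCommGroup M]
    [AddCommGroup N] [AddCommGroup Q] (i : K →+ N) (q : N →+ Q) (j : K → M) (r : M → Q)
    (h : M →+ N) (hi : Function.Injective i) (hex : ∀ x, q x = 0 → x ∈ Set.range i)
    (hj0 : j 0 = 0) (hr : Function.Surjective r) (hr0 : ∀ x, r x = 0 → ∃ a, j a = x)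
    (hij : ∀ a, h (j a) = i a) (hqr : ∀ x, q (h x) = r x) : Function.Bijective h := by
  constructor
  · rw [injective_iff_map_eq_zero]
    intro x hx
    obtain ⟨a, rfl⟩ := hr0 x (by rw [← hqr, hx, map_zero])
    rw [hij] at hx
    rw [(injective_iff_map_eq_zero i).1 hi a hx, hj0]
  · intro y
    obtain ⟨x, hx⟩ := hr (q y)
    obtain ⟨a, ha⟩ := hex (y - h x) (by rw [map_sub, hqr, hx, sub_self])
    exact ⟨x + j a, by rw [map_add, hij, ha]; abel⟩

/-- The homomorphism `ℤ × ℤ → A` sending the basis vectors to `u` and `v`. -/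
def pairHom {A : Type*} [AddCommGroup A] (u v : A) : ℤ × ℤ →+ A :=
  (zmultiplesHom A u).coprod (zmultiplesHom A v)

theorem pairHom_apply {A : Type*} [AddCommGroup A] (u v : A) (x : ℤ × ℤ) :
    pairHom u v x = x.1 • u + x.2 • v := by
  simp [pairHom]

/-- Every short exact sequence `0 → ⟨ℤ⟩ → T → Rℤ → 0` of `(ℤ/p)`-Mackey functors is
equivalent either to the split extension `0 → ⟨ℤ⟩ → ⟨ℤ⟩ ⊕ Rℤ → Rℤ → 0` or to the
standard extension `E_d : 0 → ⟨ℤ⟩ → A[d] → Rℤ → 0` for some `d` with `p ∤ d`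
(inclusion `a ↦ (p·a, −d·a)` and quotient `(a,b) ↦ d·a + p·b`, identity at level `G/e`).
In particular `T ≅ ⟨ℤ⟩ ⊕ Rℤ` or `T ≅ A[d]` for some `d` with `p ∤ d`. -/
theorem stmt4 (p : ℕ) (hp : p.Prime) (T0 T1 : Type) [AddCommGroup T0] [AddCommGroup T1]
    (T : Mackey p T0 T1) (i : MackeyHom (concZ p) T) (q : MackeyHom T (RZ p))
    (hi0 : Function.Injective i.f0) (hq0 : Function.Surjective q.f0)
    (hex0 : ∀ x : T0, q.f0 x = 0 ↔ x ∈ Set.range i.f0)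
    (hi1 : Function.Injective i.f1) (hq1 : Function.Surjective q.f1)
    (hex1 : ∀ x : T1, q.f1 x = 0 ↔ x ∈ Set.range i.f1) :
    (∃ h : MackeyHom (SplitM p) T,
      Function.Bijective h.f0 ∧ Function.Bijective h.f1 ∧
      (∀ a : ℤ, h.f0 (a, 0) = i.f0 a) ∧
      (∀ u : PUnit, h.f1 (u, 0) = i.f1 u) ∧
      (∀ x : ℤ × ℤ, q.f0 (h.f0 x) = x.2) ∧
      (∀ y : PUnit × ℤ, q.f1 (h.f1 y) = y.2)) ∨
    (∃ d : ℤ, ¬ (p : ℤ) ∣ d ∧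
      ∃ h : MackeyHom (AM p d) T,
        Function.Bijective h.f0 ∧ Function.Bijective h.f1 ∧
        (∀ a : ℤ, h.f0 ((p : ℤ) * a, -(d * a)) = i.f0 a) ∧
        (∀ x : ℤ × ℤ, q.f0 (h.f0 x) = d * x.1 + (p : ℤ) * x.2) ∧
        (∀ c : ℤ, q.f1 (h.f1 c) = c)) := by
  have hq1i : Function.Injective q.f1 := by
    rw [injective_iff_map_eq_zero]
    intro x hx
    obtain ⟨u, rfl⟩ := (hex1 x).1 hx
    rw [Subsingleton.elim u 0, map_zero]
  let E : T1 ≃+ ℤ := AddEquiv.ofBijective q.f1 ⟨hq1i, hq1⟩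
  have hE : ∀ c, q.f1 (E.symm c) = c := E.apply_symm_apply
  have hres : ∀ x, q.f1 (T.res x) = q.f0 x := q.comm_res
  have htr : ∀ x, q.f0 (T.tr x) = (p : ℤ) * q.f1 x := q.comm_tr
  have hconj : ∀ x, T.conj x = x := fun x => hq1i (q.comm_conj x)
  have hqi : ∀ a, q.f0 (i.f0 a) = 0 := fun a => (hex0 _).2 ⟨a, rfl⟩
  have hismul : ∀ a, i.f0 a = a • i.f0 1 := fun a => by
    rw [← map_zsmul, smul_eq_mul, mul_one]
  have htrE : ∀ c, T.tr (E.symm c) = c • T.tr (E.symm 1) := fun c => by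
    rw [← map_zsmul, ← map_zsmul, smul_eq_mul, mul_one]
  obtain ⟨v, hv⟩ := hq0 1
  obtain ⟨k, hk⟩ := (hex0 (T.tr (E.symm 1) - (p : ℤ) • v)).1 (by
    rw [map_sub, htr, hE, map_zsmul, hv, smul_eq_mul, sub_self])
  have ht : T.tr (E.symm 1) = k • i.f0 1 + (p : ℤ) • v := by
    rw [← hismul, hk, sub_add_cancel]
  by_cases hpk : (p : ℤ) ∣ k
  · left
    obtain ⟨m, rfl⟩ := hpk
    have hqh : ∀ x, q.f0 (pairHom (i.f0 1) (m • i.f0 1 + v) x) = x.2 := fun x => by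
      simp [pairHom_apply, hqi, hv]
    have hih : ∀ a : ℤ, pairHom (i.f0 1) (m • i.f0 1 + v) (a, 0) = i.f0 a := fun a => by
      simp [pairHom_apply, hismul a]
    refine ⟨{ f0 := pairHom (i.f0 1) (m • i.f0 1 + v)
              f1 := (E.symm : ℤ →+ T1).comp (AddMonoidHom.snd PUnit ℤ)
              comm_res := fun x => hq1i ?_
              comm_tr := fun y => ?_
              comm_conj := fun y => (hconj _).symm }, ?_, ?_, hih, fun u => ?_, hqh,
      fun y => hE y.2⟩
    · rw [hres, hqh]
      exact hE x.2
    · change pairHom (i.f0 1) (m • i.f0 1 + v) (0, (p : ℤ) * y.2) = T.tr (E.symm y.2)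
      rw [htrE, ht, pairHom_apply]
      module
    · exact bijective_of_extension_map i.f0 q.f0 (fun a => (a, 0)) Prod.snd _ hi0
        (fun x => (hex0 x).1) rfl Prod.snd_surjective
        (fun x hx => ⟨x.1, Prod.ext rfl hx.symm⟩) hih hqh
    · exact E.symm.bijective.comp
        ⟨fun a b hab => Prod.ext (Subsingleton.elim _ _) hab, Prod.snd_surjective⟩
    · rw [Subsingleton.elim u 0, map_zero]
      exact map_zero E.symm
  · right
    obtain ⟨m, n, hmn⟩ : IsCoprime (p : ℤ) k :=
      (Nat.prime_iff_prime_int.1 hp).coprime_iff_not_dvd.2 hpk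
    obtain ⟨d, rfl⟩ : ∃ d, n = -d := ⟨-n, (neg_neg n).symm⟩
    have hqh : ∀ x, q.f0 (pairHom (m • i.f0 1 + d • v) (T.tr (E.symm 1)) x) =
        d * x.1 + (p : ℤ) * x.2 := fun x => by
      simp [pairHom_apply, hqi, hv, htr, hE, mul_comm]
    have hih : ∀ a : ℤ, pairHom (m • i.f0 1 + d • v) (T.tr (E.symm 1))
        ((p : ℤ) * a, -(d * a)) = i.f0 a := fun a => by
      have ha : a = a * (m * p + -d * k) := by rw [hmn, mul_one]
      rw [hismul a, pairHom_apply, ht]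
      conv_rhs => rw [ha]
      module
    refine ⟨d, fun hd => ?_, { f0 := pairHom (m • i.f0 1 + d • v) (T.tr (E.symm 1))
                               f1 := (E.symm : ℤ →+ T1)
                               comm_res := fun x => hq1i ?_
                               comm_tr := fun c => ?_
                               comm_conj := fun c => (hconj _).symm },
      ?_, E.symm.bijective, hih, hqh, hE⟩
    · refine (Nat.prime_iff_prime_int.1 hp).not_dvd_one ?_
      rw [← hmn]
      exact dvd_add (dvd_mul_left _ _) ((hd.neg_right).mul_right k)
    · rw [hres, hqh]
      exact hE _
    · change pairHom (m • i.f0 1 + d • v) (T.tr (E.symm 1)) (0, c) = T.tr (E.symm c)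
      rw [htrE c, pairHom_apply, zero_smul, zero_add]
    · refine bijective_of_extension_map i.f0 q.f0 (fun a => ((p : ℤ) * a, -(d * a)))
        (fun x => d * x.1 + (p : ℤ) * x.2) _ hi0 (fun x => (hex0 x).1) (by simp)
        (fun y => ⟨(-k * y, m * y), by linear_combination y * hmn⟩) ?_ hih hqh
      rintro ⟨a, b⟩ hab
      exact ⟨m * a + k * b, Prod.ext (by linear_combination a * hmn + k * hab)
        (by linear_combination b * hmn - m * hab)⟩
end

section
/- Let p be a prime and d, m ∈ ℤ with p ∤ d and p ∤ m. Suppose 0 → ⟨ℤ⟩ → T → Rℤ → 0 is a short exact sequence of (ℤ/p)-Mackey functors and h : A[d] → T is a Mackey morphism making a commutative ladder from the standard extension E_d to the given sequence whose left-hand vertical map is the identity of ⟨ℤ⟩ and whose right-hand vertical map is multiplication by m on Rℤ (at both levels). Then T is isomorphic as a Mackey functor to A[m·d]. -/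
/-- Suppose `0 → ⟨ℤ⟩ → T → Rℤ → 0` is a short exact sequence of `(ℤ/p)`-Mackey functors
and `h : A[d] → T` is a Mackey morphism making a commutative ladder from the standard
extension `E_d` to the given sequence whose left vertical map is the identity of `⟨ℤ⟩`
and whose right vertical map is multiplication by `m` on `Rℤ` (at both levels), with
`p ∤ d` and `p ∤ m`.  Then `T` is isomorphic as a Mackey functor to `A[m·d]`. -/
theorem stmt6 (p : ℕ) (hp : p.Prime) (d m : ℤ) (hd : ¬ (p : ℤ) ∣ d) (hm : ¬ (p : ℤ) ∣ m)
    (T0 T1 : Type) [AddCommGroup T0] [AddCommGroup T1]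
    (T : Mackey p T0 T1) (i : MackeyHom (concZ p) T) (q : MackeyHom T (RZ p))
    (hi0 : Function.Injective i.f0) (hq0 : Function.Surjective q.f0)
    (hex0 : ∀ x : T0, q.f0 x = 0 ↔ x ∈ Set.range i.f0)
    (hi1 : Function.Injective i.f1) (hq1 : Function.Surjective q.f1)
    (hex1 : ∀ x : T1, q.f1 x = 0 ↔ x ∈ Set.range i.f1)
    (h : MackeyHom (AM p d) T)
    (hladder_incl : ∀ a : ℤ, h.f0 ((p : ℤ) * a, -(d * a)) = i.f0 a)
    (hladder_q0 : ∀ x : ℤ × ℤ, q.f0 (h.f0 x) = m * (d * x.1 + (p : ℤ) * x.2))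
    (hladder_q1 : ∀ c : ℤ, q.f1 (h.f1 c) = m * c) :
    ∃ g : MackeyHom (AM p (m * d)) T,
      Function.Bijective g.f0 ∧ Function.Bijective g.f1 := by
  have q1_inj : Function.Injective q.f1 := by
    refine (injective_iff_map_eq_zero _).2 fun x hx => ?_
    obtain ⟨z, rfl⟩ := (hex1 x).1 hx
    rw [Subsingleton.elim z 0, map_zero]
  have q_res : ∀ x, q.f1 (T.res x) = q.f0 x := q.comm_res
  have q_tr : ∀ x, q.f0 (T.tr x) = (p : ℤ) * q.f1 x := q.comm_tr
  have q_conj : ∀ x, q.f1 (T.conj x) = q.f1 x := q.comm_conj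
  obtain ⟨u, hu⟩ := hq1 1
  have f1_one : h.f1 1 = m • u := q1_inj (by simp [hladder_q1, hu])
  have f0_tr : h.f0 (0, 1) = m • T.tr u := by
    rw [← map_zsmul, ← f1_one]
    exact h.comm_tr 1
  have q0_y : q.f0 (h.f0 (1, 0)) = m * d := by simp [hladder_q0]
  let g0 : ℤ × ℤ →+ T0 :=
    (zmultiplesHom T0 (h.f0 (1, 0))).coprod (zmultiplesHom T0 (T.tr u))
  have g0_apply : ∀ a b : ℤ, g0 (a, b) = a • h.f0 (1, 0) + b • T.tr u := fun a b => by
    simp [g0]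
  have q_g0 : ∀ a b : ℤ, q.f0 (g0 (a, b)) = m * d * a + p * b := fun a b => by
    simp [g0_apply, q0_y, q_tr, hu]
    ring
  have g0_ker : ∀ k : ℤ, g0 (p * k, -(m * d * k)) = i.f0 k := fun k => by
    have hk : ((p : ℤ) * k, -(d * k)) =
        ((p : ℤ) * k) • ((1 : ℤ), (0 : ℤ)) + (-(d * k)) • ((0 : ℤ), (1 : ℤ)) := by simp
    rw [← hladder_incl, hk, map_add, map_zsmul, map_zsmul, f0_tr, smul_smul, g0_apply]
    congr 2
    ring
  have hp' : Prime (p : ℤ) := Nat.prime_iff_prime_int.1 hp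
  have hmd : ¬ (p : ℤ) ∣ m * d := fun hdvd => (hp'.dvd_or_dvd hdvd).elim hm hd
  have hcop : IsCoprime (p : ℤ) (m * d) := (hp'.coprime_iff_not_dvd).2 hmd
  refine ⟨⟨g0, zmultiplesHom T1 u, ?_, ?_, ?_⟩, ⟨?_, ?_⟩, ?_, ?_⟩
  · rintro ⟨a, b⟩
    apply q1_inj
    rw [q_res, q_g0]
    simp [AM, hu]
  · intro c
    simp [AM, g0_apply]
  · intro c
    apply q1_inj
    rw [q_conj]
    rfl
  · refine (injective_iff_map_eq_zero _).2 ?_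
    rintro ⟨a, b⟩ hab
    have hq := q_g0 a b
    rw [show g0 (a, b) = 0 from hab, map_zero] at hq
    obtain ⟨k, rfl⟩ : (p : ℤ) ∣ a := hcop.dvd_of_dvd_mul_left ⟨-b, by linarith⟩
    obtain rfl : b = -(m * d * k) :=
      mul_left_cancel₀ hp'.ne_zero (by linarith)
    have hk : i.f0 k = 0 := (g0_ker k).symm.trans hab
    obtain rfl : k = 0 := hi0 (hk.trans (map_zero _).symm)
    simp
  · intro x
    obtain ⟨t, s, hts⟩ := hcop
    obtain ⟨k, hk⟩ := (hex0 (x - g0 (s * q.f0 x, t * q.f0 x))).1 (by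
      rw [map_sub, q_g0]
      linear_combination (-q.f0 x) * hts)
    refine ⟨(p * k, -(m * d * k)) + (s * q.f0 x, t * q.f0 x), ?_⟩
    change g0 _ = x
    rw [map_add, g0_ker, hk, sub_add_cancel]
  · intro a b hab
    simpa [hu] using congrArg q.f1 hab
  · intro x
    exact ⟨q.f1 x, q1_inj (by simp [hu])⟩
end

section
/- Let p be a prime and d₁, d₂ ∈ ℤ. The (ℤ/p)-Mackey functors A[d₁] and A[d₂] are isomorphic if and only if d₁ ≡ d₂ (mod p) or d₁ ≡ −d₂ (mod p). Consequently, among the A[d] for d ∈ ℤ there are exactly two isomorphism classes when p = 2 and exactly (p+1)/2 isomorphism classes when p is odd. -/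
/-- `A[d₁] ≅ A[d₂]` as `(ℤ/p)`-Mackey functors. -/
def MIso (p : ℕ) (d₁ d₂ : ℤ) : Prop :=
  ∃ h : MackeyHom (AM p d₁) (AM p d₂),
    Function.Bijective h.f0 ∧ Function.Bijective h.f1

theorem MIso.modEq_or_modEq_neg {p : ℕ} {d₁ d₂ : ℤ} (h : MIso p d₁ d₂) :
    d₁ ≡ d₂ [ZMOD (p : ℤ)] ∨ d₁ ≡ -d₂ [ZMOD (p : ℤ)] := by
  obtain ⟨⟨f0, f1, hres, htr, _⟩, h0, h1⟩ := h
  have hf1 : ∀ x : ℤ, f1 x = x * f1 1 := fun x => by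
    simpa using map_zsmul f1 x (1 : ℤ)
  have hu : IsUnit (f1 1) := by
    obtain ⟨x, hx⟩ := h1.2 1
    exact IsUnit.of_mul_eq_one_right x ((hf1 x).symm.trans hx)
  have htr' : ∀ c : ℤ, f0 (0, c) = (0, f1 c) := htr
  have ha : IsUnit (f0 (1, 0)).1 := by
    obtain ⟨⟨x, y⟩, hx⟩ := h0.2 (1, 0)
    refine IsUnit.of_mul_eq_one_right x ?_
    have hxy : ((x, y) : ℤ × ℤ) = x • ((1, 0) : ℤ × ℤ) + (0, y) := by simp
    rw [hxy, map_add, map_zsmul, htr'] at hx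
    simpa using congrArg Prod.fst hx
  have hr : f1 (d₁ * 1 + p * 0) = d₂ * (f0 (1, 0)).1 + p * (f0 (1, 0)).2 := hres (1, 0)
  rw [hf1] at hr
  rw [Int.modEq_comm, Int.modEq_comm (a := d₁), Int.modEq_iff_dvd, Int.modEq_iff_dvd]
  rcases Int.isUnit_iff.mp hu with hu | hu <;> rcases Int.isUnit_iff.mp ha with ha | ha <;>
    rw [hu, ha] at hr
  · exact Or.inl ⟨(f0 (1, 0)).2, by linarith⟩
  · exact Or.inr ⟨(f0 (1, 0)).2, by linarith⟩
  · exact Or.inr ⟨-(f0 (1, 0)).2, by linarith⟩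
  · exact Or.inl ⟨-(f0 (1, 0)).2, by linarith⟩

theorem MIso.of_eq_mul_add {p : ℕ} {d₁ d₂ e b : ℤ} (he : e * e = 1)
    (h : d₁ = d₂ * e + p * b) : MIso p d₁ d₂ := by
  refine ⟨⟨AddMonoidHom.mk' (fun x : ℤ × ℤ => (e * x.1, b * x.1 + x.2)) ?_,
    AddMonoidHom.id ℤ, ?_, ?_, fun _ => rfl⟩, ?_, Function.bijective_id⟩
  · intro x y
    ext <;> simp <;> ring
  · rintro ⟨x, y⟩
    simp only [AM, AddMonoidHom.mk'_apply, AddMonoidHom.id_apply, h]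
    ring
  · intro c
    simp [AM]
  · refine Function.bijective_iff_has_inverse.mpr
      ⟨fun x => (e * x.1, x.2 - b * (e * x.1)), ?_, ?_⟩
    · rintro ⟨x, y⟩
      simp [← mul_assoc, he]
    · rintro ⟨x, y⟩
      simp [← mul_assoc, he]

theorem mIso_iff {p : ℕ} {d₁ d₂ : ℤ} : MIso p d₁ d₂ ↔
    (d₁ ≡ d₂ [ZMOD (p : ℤ)] ∨ d₁ ≡ -d₂ [ZMOD (p : ℤ)]) := by
  refine ⟨MIso.modEq_or_modEq_neg, ?_⟩
  rintro (h | h) <;> obtain ⟨b, hb⟩ := Int.modEq_iff_dvd.mp h.symm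
  · exact MIso.of_eq_mul_add (e := 1) (b := b) (by norm_num) (by linarith)
  · exact MIso.of_eq_mul_add (e := -1) (b := b) (by norm_num) (by linarith)

theorem mIso_iff_natAbs_valMinAbs {p : ℕ} {d₁ d₂ : ℤ} : MIso p d₁ d₂ ↔
    (d₁ : ZMod p).valMinAbs.natAbs = (d₂ : ZMod p).valMinAbs.natAbs := by
  rw [mIso_iff, ZMod.natAbs_valMinAbs_eq_natAbs_valMinAbs, ← ZMod.intCast_eq_intCast_iff,
    ← ZMod.intCast_eq_intCast_iff, Int.cast_neg]

theorem card_quot_mIso (p : ℕ) [NeZero p] : Nat.card (Quot (MIso p)) = p / 2 + 1 := by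
  let f : Quot (MIso p) → Fin (p / 2 + 1) :=
    Quot.lift (fun d : ℤ => ⟨(d : ZMod p).valMinAbs.natAbs,
      Nat.lt_succ_of_le (ZMod.natAbs_valMinAbs_le _)⟩)
      fun _ _ h => Fin.ext (mIso_iff_natAbs_valMinAbs.mp h)
  have hf : Function.Bijective f := by
    constructor
    · rintro ⟨a⟩ ⟨b⟩ h
      exact Quot.sound (mIso_iff_natAbs_valMinAbs.mpr (congrArg Fin.val h))
    · rintro ⟨k, hk⟩
      refine ⟨Quot.mk _ (k : ℤ), Fin.ext ?_⟩
      simp [f, ZMod.valMinAbs_natCast_of_le_half (Nat.le_of_lt_succ hk)]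
  rw [Nat.card_eq_of_bijective f hf, Nat.card_fin]

/-- `A[d₁] ≅ A[d₂]` iff `d₁ ≡ d₂ (mod p)` or `d₁ ≡ −d₂ (mod p)`; consequently, among
the `A[d]` for `d ∈ ℤ` there are exactly `2` isomorphism classes when `p = 2` and
exactly `(p+1)/2` when `p` is odd. -/
theorem stmt7 (p : ℕ) (hp : p.Prime) :
    (∀ d₁ d₂ : ℤ, MIso p d₁ d₂ ↔
      (d₁ ≡ d₂ [ZMOD (p : ℤ)] ∨ d₁ ≡ -d₂ [ZMOD (p : ℤ)])) ∧
    Nat.card (Quot (MIso p)) = if p = 2 then 2 else (p + 1) / 2 := by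
  have : NeZero p := ⟨hp.ne_zero⟩
  refine ⟨fun _ _ => mIso_iff, ?_⟩
  rw [card_quot_mIso]
  rcases hp.eq_two_or_odd with rfl | h
  · simp
  · rw [if_neg (by omega)]
    omega
end

section
/- Let p be a prime and d ∈ ℤ with p ∤ d. Suppose 0 → ℤ →j→ T →q→ ℤ/pℤ → 0 is a short exact sequence of abelian groups and η : ℤ ⊕ ℤ → T is a group homomorphism satisfying η(0, 1) = 0, η(p, −d) = j(1), and q(η(a, b)) = d·a (mod p) for all (a, b) ∈ ℤ ⊕ ℤ. Then there is an isomorphism e : T ≅ ℤ such that e(j(n)) = p·n for all n ∈ ℤ, q(x) = d · (e(x) mod p) for all x ∈ T, and e(η(1, 0)) = 1. -/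
/-- Let `p` be a prime and `d ∈ ℤ` with `p ∤ d`.  Suppose `0 → ℤ →j→ T →q→ ℤ/pℤ → 0` is a
short exact sequence of abelian groups and `η : ℤ ⊕ ℤ → T` is a homomorphism with
`η (0,1) = 0`, `η (p, −d) = j 1` and `q (η (a,b)) = d·a (mod p)`.  Then there is an
isomorphism `e : T ≅ ℤ` with `e (j n) = p·n`, `q x = d · (e x mod p)` and
`e (η (1,0)) = 1`. -/
theorem stmt9 (p : ℕ) (hp : p.Prime) (d : ℤ) (hd : ¬ (p : ℤ) ∣ d)
    (T : Type) [AddCommGroup T]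
    (j : ℤ →+ T) (q : T →+ ZMod p)
    (hj : Function.Injective j) (hq : Function.Surjective q)
    (hexact : ∀ x : T, q x = 0 ↔ x ∈ Set.range j)
    (η : ℤ × ℤ →+ T)
    (hη1 : η (0, 1) = 0)
    (hη2 : η ((p : ℤ), -d) = j 1)
    (hη3 : ∀ x : ℤ × ℤ, q (η x) = (d : ZMod p) * ((x.1 : ℤ) : ZMod p)) :
    ∃ e : T ≃+ ℤ, (∀ n : ℤ, e (j n) = (p : ℤ) * n) ∧
      (∀ x : T, q x = (d : ZMod p) * ((e x : ℤ) : ZMod p)) ∧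
      e (η (1, 0)) = 1 := by
  have : Fact p.Prime := ⟨hp⟩
  have hd0 : (d : ZMod p) ≠ 0 := fun h => hd ((ZMod.intCast_zmod_eq_zero_iff_dvd d p).1 h)
  set t : T := η (1, 0) with ht
  have hjt (n : ℤ) : j n = ((p : ℤ) * n) • t := by
    have hsplit : ((p : ℤ), -d) = (p : ℤ) • ((1, 0) : ℤ × ℤ) + (-d) • ((0, 1) : ℤ × ℤ) := by
      simp
    have h1 : j 1 = (p : ℤ) • t := by
      rw [← hη2, hsplit, map_add, map_zsmul, map_zsmul, hη1, smul_zero, add_zero]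
    calc j n = j (n • (1 : ℤ)) := by simp
      _ = ((p : ℤ) * n) • t := by rw [map_zsmul, h1, smul_smul, mul_comm]
  have hqt (n : ℤ) : q (n • t) = (d : ZMod p) * (n : ZMod p) := by
    rw [ht, ← map_zsmul, hη3]
    simp
  have hinj : Function.Injective (zmultiplesHom T t) := by
    rw [injective_iff_map_eq_zero]
    intro n hn
    rw [zmultiplesHom_apply] at hn
    refine hj ?_
    rw [hjt, mul_smul, hn, smul_zero, map_zero]
  have hsurj : Function.Surjective (zmultiplesHom T t) := by
    intro x
    obtain ⟨a, ha⟩ := ZMod.intCast_surjective ((d : ZMod p)⁻¹ * q x)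
    have hker : q (x - a • t) = 0 := by
      rw [map_sub, hqt, ha, mul_inv_cancel_left₀ hd0, sub_self]
    obtain ⟨m, hm⟩ := (hexact _).1 hker
    refine ⟨(p : ℤ) * m + a, ?_⟩
    rw [zmultiplesHom_apply, add_smul, ← hjt, hm, sub_add_cancel]
  let f : ℤ ≃+ T := AddEquiv.ofBijective (zmultiplesHom T t) ⟨hinj, hsurj⟩
  have hf (n : ℤ) : f n = n • t := rfl
  refine ⟨f.symm, fun n => ?_, fun x => ?_, ?_⟩
  · rw [AddEquiv.symm_apply_eq, hf, hjt]
  · rw [← hqt, ← hf, AddEquiv.apply_symm_apply]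
  · rw [AddEquiv.symm_apply_eq, hf, one_smul]
end

section
/- Let p be a prime, c : Fin p → ℤ, and N ∈ ℤ be such that c_k + N is even for every k and c_k + N ≥ 0 for at least one k. Then the number of triples (m, n, ε), with m, n : Fin p → ℕ and ε : Fin p → {0, 1}, satisfying the admissibility conditions together with 2((m_k : ℤ) − (n_k : ℤ)) = c_k + N for every k, is exactly the number of indices k ∈ Fin p with c_k + N ≥ 0. -/
/-- The admissibility conditions on a triple `(m, n, ε)` with `m, n : Fin p → ℕ` and
`ε : Fin p → {0,1}`:
(i) if `m_k > 0` or `ε_k = 1` then `n_k = 0`;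
(ii) for at least one `k`, `ε_k = 0` and `n_k = 0`;
(iii) if `ε_k = 1` and `j` strictly precedes `k` in the ordering of `m − n` from highest
to lowest (ties broken by the natural order of indices), then `ε_j = 1`. -/
def Adm (p : ℕ) (m n : Fin p → ℕ) (ε : Fin p → Fin 2) : Prop :=
  (∀ k, (0 < m k ∨ ε k = 1) → n k = 0) ∧
  (∃ k, ε k = 0 ∧ n k = 0) ∧
  (∀ j k, ε k = 1 →
    (((m j : ℤ) - (n j : ℤ) > (m k : ℤ) - (n k : ℤ)) ∨
      ((m j : ℤ) - (n j : ℤ) = (m k : ℤ) - (n k : ℤ) ∧ j < k)) → ε j = 1)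

/-- The indices ordered by decreasing value of `d`, ties broken by the natural order. -/
def descKey {p : ℕ} (d : Fin p → ℤ) (k : Fin p) : ℤ ×ₗ Fin p := toLex (-d k, k)

lemma descKey_lt {p : ℕ} (d : Fin p → ℤ) (j k : Fin p) :
    descKey d j < descKey d k ↔ d k < d j ∨ (d j = d k ∧ j < k) := by
  simp [descKey, Prod.Lex.toLex_lt_toLex]

lemma descKey_injective {p : ℕ} (d : Fin p → ℤ) : Function.Injective (descKey d) := by
  intro j k h
  exact congrArg (fun x => (ofLex x).2) h

/-- The indicator of the indices strictly preceding `k` in the order given by `descKey d`. -/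
def precIndicator {p : ℕ} (d : Fin p → ℤ) (k j : Fin p) : Fin 2 :=
  if descKey d j < descKey d k then 1 else 0

lemma precIndicator_eq_one {p : ℕ} (d : Fin p → ℤ) (k j : Fin p) :
    precIndicator d k j = 1 ↔ descKey d j < descKey d k := by
  simp [precIndicator]

lemma precIndicator_injective {p : ℕ} (d : Fin p → ℤ) :
    Function.Injective (precIndicator d) := by
  intro k l h
  have key : ∀ j, descKey d j < descKey d k ↔ descKey d j < descKey d l := fun j => by
    rw [← precIndicator_eq_one, ← precIndicator_eq_one, h]
  apply descKey_injective d
  refine le_antisymm (not_lt.1 fun hlt => ?_) (not_lt.1 fun hlt => ?_)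
  · exact lt_irrefl _ ((key l).1 hlt)
  · exact lt_irrefl _ ((key k).2 hlt)

lemma adm_precIndicator {p : ℕ} (d : Fin p → ℤ) {k : Fin p} (hk : 0 ≤ d k) :
    Adm p (fun j => (d j).toNat) (fun j => (-d j).toNat) (precIndicator d k) := by
  refine ⟨fun j hj => ?_, ⟨k, by simp [precIndicator], by simpa using hk⟩, fun i j hj hij => ?_⟩
  · rw [precIndicator_eq_one, descKey_lt] at hj
    dsimp only at hj ⊢
    omega
  · rw [precIndicator_eq_one] at hj ⊢
    refine lt_trans ((descKey_lt d i j).2 ?_) hj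
    dsimp only at hij
    omega

lemma Adm.exists_eq_precIndicator {p : ℕ} {m n : Fin p → ℕ} {ε : Fin p → Fin 2}
    (h : Adm p m n ε) {d : Fin p → ℤ} (hd : ∀ k, (m k : ℤ) - n k = d k) :
    ∃ k, 0 ≤ d k ∧ ε = precIndicator d k := by
  obtain ⟨h1, ⟨k₀, hk₀⟩, h3⟩ := h
  obtain ⟨k, hk, hmin⟩ := Finset.exists_min_image
    (Finset.univ.filter fun k => ε k = 0 ∧ n k = 0) (descKey d) ⟨k₀, by simpa using hk₀⟩
  simp only [Finset.mem_filter, Finset.mem_univ, true_and] at hk hmin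
  have hdk := hd k
  have hεk := hk.1
  refine ⟨k, by omega, funext fun j => ?_⟩
  by_cases hj : descKey d j < descKey d k
  · rw [(precIndicator_eq_one d k j).2 hj]
    by_contra hε
    have hnj : n j = 0 := by
      have := (descKey_lt d j k).1 hj
      have := hd j
      have := h1 j
      omega
    exact absurd hj (not_lt.2 (hmin j ⟨by omega, hnj⟩))
  · rw [precIndicator, if_neg hj]
    by_contra hε
    have hε1 : ε j = 1 := by omega
    have hne : descKey d k ≠ descKey d j := fun he => by
      rw [descKey_injective d he] at hεk
      exact hε hεk
    have hlt := (descKey_lt d k j).1 (lt_of_le_of_ne (not_lt.1 hj) hne)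
    have := h3 k j hε1 (by rw [hd, hd]; exact hlt)
    omega

/-- Let `p` be a prime, `c : Fin p → ℤ` and `N ∈ ℤ` with `c_k + N` even for all `k` and
`c_k + N ≥ 0` for at least one `k`.  Then the number of admissible triples `(m, n, ε)`
with `2(m_k − n_k) = c_k + N` for all `k` equals the number of indices `k` with
`c_k + N ≥ 0`. -/
theorem stmt10 (p : ℕ) (hp : p.Prime) (c : Fin p → ℤ) (N : ℤ)
    (heven : ∀ k, Even (c k + N)) (hpos : ∃ k, 0 ≤ c k + N) :
    Nat.card {t : (Fin p → ℕ) × (Fin p → ℕ) × (Fin p → Fin 2) //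
        Adm p t.1 t.2.1 t.2.2 ∧
        ∀ k, 2 * ((t.1 k : ℤ) - (t.2.1 k : ℤ)) = c k + N} =
      (Finset.univ.filter fun k : Fin p => 0 ≤ c k + N).card := by
  choose d hd using heven
  have hd' : ∀ k, 0 ≤ c k + N ↔ 0 ≤ d k := fun k => by rw [hd]; omega
  let f : {k // k ∈ Finset.univ.filter fun k : Fin p => 0 ≤ c k + N} →
      {t : (Fin p → ℕ) × (Fin p → ℕ) × (Fin p → Fin 2) //
        Adm p t.1 t.2.1 t.2.2 ∧ ∀ k, 2 * ((t.1 k : ℤ) - (t.2.1 k : ℤ)) = c k + N} :=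
    fun k => ⟨(fun j => (d j).toNat, fun j => (-d j).toNat, precIndicator d k),
      adm_precIndicator d ((hd' k).1 (Finset.mem_filter.1 k.2).2),
      fun j => by rw [hd]; dsimp only; omega⟩
  have hf : Function.Bijective f := by
    constructor
    · intro k l hkl
      exact Subtype.ext (precIndicator_injective d (congrArg (fun t => t.1.2.2) hkl))
    · rintro ⟨⟨m, n, ε⟩, hadm, hmn⟩
      dsimp only at hadm hmn
      have hmn' : ∀ k, (m k : ℤ) - n k = d k := fun k => by
        have := hmn k
        rw [hd] at this
        omega
      obtain ⟨k, hk, rfl⟩ := hadm.exists_eq_precIndicator hmn'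
      refine ⟨⟨k, by simpa [hd'] using hk⟩, Subtype.ext (Prod.ext ?_ (Prod.ext ?_ rfl))⟩ <;>
      · funext j
        have := hadm.1 j
        have := hmn' j
        dsimp only [f]
        omega
  rw [← Nat.card_eq_of_bijective f hf, Nat.card_eq_fintype_card, Fintype.card_coe]
end

section
/- Let p be a prime and c : Fin p → ℤ a function all of whose values have the same parity. Then for every natural number ℓ there is exactly one triple (m, n, ε), with m, n : Fin p → ℕ and ε : Fin p → {0, 1}, satisfying the admissibility conditions together with: there exists N ∈ ℤ with 2((m_k : ℤ) − (n_k : ℤ)) = c_k + N for every k, and Σ_k (m_k + ε_k) = ℓ. -/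
/-- If the weights of one admissible triple are a positive shift of the weights of another, then
its dimension is strictly larger. -/
theorem Adm.sum_lt_of_shift_pos {p : ℕ} {m n m' n' : Fin p → ℕ} {ε ε' : Fin p → Fin 2}
    (h : Adm p m n ε) {d : ℤ} (hd : 0 < d)
    (hs : ∀ k, (m' k : ℤ) - n' k = (m k : ℤ) - n k + d) :
    ∑ k, (m k + (ε k : ℕ)) < ∑ k, (m' k + (ε' k : ℕ)) := by
  obtain ⟨h1, ⟨k₀, hε, hn⟩, -⟩ := h
  refine Finset.sum_lt_sum (fun k _ => ?_) ⟨k₀, Finset.mem_univ _, ?_⟩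
  · have := h1 k
    have := hs k
    omega
  · have := hs k₀
    simp only [hε, Fin.val_zero]
    omega

/-- Admissible triples with equal weights have comparable `ε`. -/
theorem Adm.le_or_le {p : ℕ} {m n : Fin p → ℕ} {ε ε' : Fin p → Fin 2}
    (h : Adm p m n ε) (h' : Adm p m n ε') : ε ≤ ε' ∨ ε' ≤ ε := by
  by_contra! hc
  simp only [Pi.le_def, not_forall, not_le] at hc
  obtain ⟨⟨j, hj⟩, k, hk⟩ := hc
  have h3 := h.2.2 k j (by omega)
  have h3' := h'.2.2 j k (by omega)
  have hne : j ≠ k := by rintro rfl; omega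
  rcases lt_trichotomy ((m j : ℤ) - n j) ((m k : ℤ) - n k) with hlt | heq | hgt
  · have := h3 (Or.inl hlt)
    omega
  · rcases lt_or_gt_of_ne hne with hlt | hgt
    · have := h3' (Or.inr ⟨heq, hlt⟩)
      omega
    · have := h3 (Or.inr ⟨heq.symm, hgt⟩)
      omega
  · have := h3' (Or.inl hgt)
    omega

/-- Admissible triples of equal dimension whose weights differ by a constant are equal. -/
theorem Adm.eq_of_shift {p : ℕ} {m n m' n' : Fin p → ℕ} {ε ε' : Fin p → Fin 2}
    (h : Adm p m n ε) (h' : Adm p m' n' ε') {d : ℤ}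
    (hs : ∀ k, (m' k : ℤ) - n' k = (m k : ℤ) - n k + d)
    (hsum : ∑ k, (m k + (ε k : ℕ)) = ∑ k, (m' k + (ε' k : ℕ))) :
    m = m' ∧ n = n' ∧ ε = ε' := by
  rcases lt_trichotomy d 0 with hd | rfl | hd
  · have := h'.sum_lt_of_shift_pos (m' := m) (n' := n) (ε' := ε) (d := -d) (by omega)
      (fun k => by have := hs k; omega)
    omega
  · have hmn : ∀ k, m k = m' k ∧ n k = n' k := fun k => by
      have := hs k
      have := h.1 k
      have := h'.1 k
      omega
    obtain rfl : m = m' := funext fun k => (hmn k).1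
    obtain rfl : n = n' := funext fun k => (hmn k).2
    have eq_of_le : ∀ {δ δ' : Fin p → Fin 2}, δ ≤ δ' →
        ∑ k, (m k + (δ k : ℕ)) = ∑ k, (m k + (δ' k : ℕ)) → δ = δ' := fun hle he => by
      have hle' := (Finset.sum_eq_sum_iff_of_le fun k _ => Nat.add_le_add_left (hle k) (m k)).1 he
      exact funext fun k => Fin.ext (Nat.add_left_cancel (hle' k (Finset.mem_univ k)))
    refine ⟨rfl, rfl, ?_⟩
    rcases h.le_or_le h' with hle | hle
    · exact eq_of_le hle hsum
    · exact (eq_of_le hle hsum.symm).symm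
  · have := h.sum_lt_of_shift_pos (ε' := ε') hd hs
    omega

/-- From an admissible triple one obtains, shifting the weights by a constant, an admissible
triple whose dimension is larger by one. -/
theorem Adm.exists_succ {p : ℕ} {m n : Fin p → ℕ} {ε : Fin p → Fin 2} (h : Adm p m n ε) :
    ∃ (m' n' : Fin p → ℕ) (ε' : Fin p → Fin 2) (d : ℤ), Adm p m' n' ε' ∧
      (∀ k, (m' k : ℤ) - n' k = (m k : ℤ) - n k + d) ∧
      ∑ k, (m' k + (ε' k : ℕ)) = ∑ k, (m k + (ε k : ℕ)) + 1 := by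
  obtain ⟨h1, ⟨k₀, hk₀⟩, h3⟩ := h
  obtain ⟨k, hk, hmin⟩ := Finset.exists_min_image
    (Finset.univ.filter fun k => ε k = 0 ∧ n k = 0)
    (fun k => toLex ((n k : ℤ) - m k, k)) ⟨k₀, by simpa using hk₀⟩
  simp only [Finset.mem_filter, Finset.mem_univ, true_and, Prod.Lex.toLex_le_toLex] at hk hmin
  obtain ⟨hεk, hnk⟩ := hk
  have hsum : ∑ j, (m j + (Function.update ε k 1 j : ℕ)) = ∑ j, (m j + (ε j : ℕ)) + 1 := by
    rw [← Finset.add_sum_erase _ _ (Finset.mem_univ k),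
      ← Finset.add_sum_erase _ (fun j => m j + (ε j : ℕ)) (Finset.mem_univ k),
      Finset.sum_congr rfl fun j hj => by
        rw [Function.update_of_ne (Finset.ne_of_mem_erase hj)]]
    simp only [Function.update_self, hεk, Fin.val_zero, Fin.val_one]
    omega
  by_cases hex : ∃ j, j ≠ k ∧ ε j = 0 ∧ n j = 0
  · obtain ⟨i, hik, hi⟩ := hex
    refine ⟨m, n, Function.update ε k 1, 0, ⟨fun j hj => ?_, ⟨i, ?_⟩, fun j l hl hjl => ?_⟩,
      fun _ => (add_zero _).symm, hsum⟩
    · rcases eq_or_ne j k with rfl | hjk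
      · exact hnk
      · exact h1 j (by simpa [hjk] using hj)
    · simpa [hik] using hi
    · rcases eq_or_ne j k with rfl | hjk
      · simp
      rw [Function.update_of_ne hjk]
      rcases eq_or_ne l k with rfl | hlk
      · by_contra hεj
        have := hmin j
        have := h1 j
        omega
      · exact h3 j l (by simpa [hlk] using hl) hjl
  · have hfull : ∀ j, n j = 0 → Function.update ε k 1 j = 1 := fun j hj => by
      rcases eq_or_ne j k with rfl | hjk
      · simp
      · rw [Function.update_of_ne hjk]
        by_contra hεj
        exact hex ⟨j, hjk, by omega, hj⟩
    refine ⟨fun j => if n j = 0 then m j + 1 else 0, fun j => n j - 1, 0, 1,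
      ⟨fun j hj => ?_, ⟨k, rfl, by simp [hnk]⟩, fun j l hl => by simp at hl⟩,
      fun j => ?_, ?_⟩
    · by_cases hn : n j = 0 <;> simp_all
    · have := h1 j
      dsimp only
      split_ifs <;> omega
    · rw [← hsum]
      refine Finset.sum_congr rfl fun j _ => ?_
      by_cases hn : n j = 0
      · simp [hn, hfull j hn]
      · have hjk : j ≠ k := by rintro rfl; exact hn hnk
        have := h1 j
        simp only [if_neg hn, Function.update_of_ne hjk, Pi.zero_apply, Fin.val_zero]
        omega

/-- For every weight function there is an admissible triple of dimension zero with these weights up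
to a constant shift. -/
theorem exists_adm_sum_eq_zero {p : ℕ} [NeZero p] (x : Fin p → ℤ) :
    ∃ (m n : Fin p → ℕ) (ε : Fin p → Fin 2) (d : ℤ), Adm p m n ε ∧
      (∀ k, (m k : ℤ) - n k = x k + d) ∧ ∑ k, (m k + (ε k : ℕ)) = 0 := by
  obtain ⟨k, hk⟩ := Finite.exists_max x
  refine ⟨0, fun j => (x k - x j).toNat, 0, -x k,
    ⟨fun j hj => by simp at hj, ⟨k, rfl, by simp⟩, fun j l hl => by simp at hl⟩,
    fun j => ?_, by simp⟩
  have := hk j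
  simp only [Pi.zero_apply]
  omega

/-- For every weight function there is an admissible triple of any given dimension with these
weights up to a constant shift. -/
theorem exists_adm_sum_eq {p : ℕ} [NeZero p] (x : Fin p → ℤ) (l : ℕ) :
    ∃ (m n : Fin p → ℕ) (ε : Fin p → Fin 2) (d : ℤ), Adm p m n ε ∧
      (∀ k, (m k : ℤ) - n k = x k + d) ∧ ∑ k, (m k + (ε k : ℕ)) = l := by
  induction l with
  | zero => exact exists_adm_sum_eq_zero x
  | succ l ih =>
    obtain ⟨m, n, ε, d, h, hs, hl⟩ := ih
    obtain ⟨m', n', ε', d', h', hs', hl'⟩ := h.exists_succ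
    exact ⟨m', n', ε', d + d', h', fun k => by rw [hs', hs, add_assoc], by rw [hl', hl]⟩

/-- Let `p` be a prime and `c : Fin p → ℤ` a function all of whose values have the same
parity.  Then for every `ℓ : ℕ` there is exactly one admissible triple `(m, n, ε)` such
that `2(m_k − n_k) = c_k + N` for all `k`, for some `N ∈ ℤ`, and `Σ_k (m_k + ε_k) = ℓ`. -/
theorem stmt11 (p : ℕ) (hp : p.Prime) (c : Fin p → ℤ)
    (hpar : ∀ k l, c k % 2 = c l % 2) (ℓ : ℕ) :
    ∃! t : (Fin p → ℕ) × (Fin p → ℕ) × (Fin p → Fin 2),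
      Adm p t.1 t.2.1 t.2.2 ∧
      (∃ N : ℤ, ∀ k, 2 * ((t.1 k : ℤ) - (t.2.1 k : ℤ)) = c k + N) ∧
      (∑ k, (t.1 k + (t.2.2 k : ℕ))) = ℓ := by
  have : NeZero p := ⟨hp.ne_zero⟩
  obtain ⟨m, n, ε, d, h, hs, hl⟩ := exists_adm_sum_eq (fun k => c k / 2) ℓ
  have hN : ∀ k, 2 * ((m k : ℤ) - n k) = c k + (2 * d - c 0 % 2) := fun k => by
    have := hs k
    have := hpar k 0
    omega
  refine ⟨(m, n, ε), ⟨h, ⟨_, hN⟩, hl⟩, ?_⟩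
  rintro ⟨m', n', ε'⟩ ⟨h', ⟨N, hN'⟩, hl'⟩
  dsimp only at h' hN' hl'
  obtain ⟨rfl, rfl, rfl⟩ := h'.eq_of_shift h (d := (m 0 - n 0) - (m' 0 - n' 0))
    (fun k => by
      have := hN k
      have := hN 0
      have := hN' k
      have := hN' 0
      omega)
    (hl'.trans hl.symm)
  rfl
end

section
/- Let p be an odd prime, d ∈ ℤ with p ∤ d, and a ∈ ℤ with a ≡ d (mod p). Then there exists a unique element x ∈ ℤ ⊕ ℤ such that d·x₁ + p·x₂ = a and x together with (0, 1) generates the group ℤ ⊕ ℤ. -/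
/-- A vector together with `(0, 1)` generates `ℤ × ℤ` iff its first coordinate is a unit. -/
theorem closure_pair_zero_one_eq_top_iff (x : ℤ × ℤ) :
    AddSubgroup.closure ({x, (0, 1)} : Set (ℤ × ℤ)) = ⊤ ↔ IsUnit x.1 := by
  rw [AddSubgroup.eq_top_iff']
  simp only [AddSubgroup.mem_closure_pair]
  constructor
  · intro h
    obtain ⟨m, n, hmn⟩ := h (1, 0)
    have h1 : m * x.1 = 1 := by simpa using congrArg Prod.fst hmn
    exact IsUnit.of_mul_eq_one_right m h1
  · rintro hx z
    obtain ⟨u, hu⟩ := hx.exists_left_inv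
    refine ⟨z.1 * u, z.2 - z.1 * u * x.2, ?_⟩
    ext
    · simp [mul_assoc, hu]
    · simp

/-- Let `p` be an odd prime, `d ∈ ℤ` with `p ∤ d`, and `a ∈ ℤ` with `a ≡ d (mod p)`.
Then there is a unique `x ∈ ℤ ⊕ ℤ` with `d·x₁ + p·x₂ = a` such that `x` together with
`(0, 1)` generates the group `ℤ ⊕ ℤ`.  (This is the concrete form of the uniqueness of
the element `μ^{α,a}` of `H_G^α(S⁰) ≅ A[ν(α)]` with `ρ(μ^{α,a}) = a·ι^α` which,
together with `ι^α`, generates.) -/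
theorem stmt12 (p : ℕ) (hp : p.Prime) (hodd : Odd p) (d a : ℤ)
    (hd : ¬ (p : ℤ) ∣ d) (ha : a ≡ d [ZMOD (p : ℤ)]) :
    ∃! x : ℤ × ℤ, d * x.1 + (p : ℤ) * x.2 = a ∧
      AddSubgroup.closure ({x, (0, 1)} : Set (ℤ × ℤ)) = ⊤ := by
  have hp0 : (p : ℤ) ≠ 0 := mod_cast hp.ne_zero
  obtain ⟨k, hk⟩ := ha.symm.dvd
  simp only [closure_pair_zero_one_eq_top_iff]
  refine ⟨(1, k), ⟨by linarith, isUnit_one⟩, ?_⟩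
  rintro ⟨y₁, y₂⟩ ⟨hy, hu⟩
  rcases Int.isUnit_iff.mp hu with rfl | rfl
  · have : (p : ℤ) * y₂ = p * k := by linarith
    rw [mul_left_cancel₀ hp0 this]
  · have hdvd : (p : ℤ) ∣ 2 * d := ⟨y₂ - k, by linarith⟩
    have hcop : IsCoprime (p : ℤ) 2 :=
      Nat.isCoprime_iff_coprime.mpr (Nat.coprime_two_right.mpr hodd)
    exact absurd (hcop.dvd_of_dvd_mul_left hdvd) hd
end

section
/- For every prime p, the Picard group of the commutative ring ℤ[X]/(X² − pX) is isomorphic to the quotient group (ℤ/pℤ)ˣ / {±1} of the unit group of ℤ/pℤ by the subgroup generated by −1. -/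
open Polynomial CategoryTheory

/-- The Burnside ring `A(ℤ/p) ≅ ℤ[X]/(X² − pX)`. -/
noncomputable abbrev BurnsideRingModel (p : ℕ) : Type :=
  Polynomial ℤ ⧸ Ideal.span {(X : Polynomial ℤ) ^ 2 - (p : Polynomial ℤ) * X}

/-- The Picard group of a commutative ring `R`: invertible `R`-modules up to isomorphism,
i.e. the group of units of the monoid of isomorphism classes of `R`-modules under tensor
product (the skeleton of the monoidal category of `R`-modules). -/
noncomputable abbrev PicardGroup (R : Type) [CommRing R] : Type 1 :=
  (Skeleton (ModuleCat.{0} R))ˣ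

/-- An invertible module over a principal ideal ring, possibly with zero divisors, is free. -/
theorem CommRing.Pic.subsingleton_of_isPrincipalIdealRing (A : Type*) [CommRing A]
    [IsPrincipalIdealRing A] : Subsingleton (CommRing.Pic A) := by
  refine CommRing.Pic.subsingleton_iff.mpr fun M _ _ _ ↦ ?_
  obtain ⟨I, ⟨e⟩⟩ := Module.Invertible.exists_linearEquiv_ideal A M
  obtain ⟨x, hx⟩ := (IsPrincipalIdealRing.principal I).principal
  have hxI : x ∈ I := hx ▸ Submodule.mem_span_singleton_self x
  have hsurj : Function.Surjective (LinearMap.toSpanSingleton A I ⟨x, hxI⟩) := by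
    rintro ⟨y, hy⟩
    obtain ⟨a, ha⟩ := Submodule.mem_span_singleton.mp (hx ▸ hy)
    exact ⟨a, Subtype.ext ha⟩
  have : Module.Invertible A I := .congr e
  exact .of_equiv ((LinearEquiv.ofBijective _
    (Module.Invertible.bijective_of_surjective hsurj)).trans e.symm)

/-- The skeletal Picard group agrees with Mathlib's Picard group. -/
noncomputable def picardGroupEquivPic (R : Type) [CommRing R] :
    PicardGroup R ≃* CommRing.Pic R :=
  (Units.mapEquiv (Skeleton.mulEquiv ModuleCat.equivalenceSemimoduleCat)).trans
    { (equivShrink _) with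
      map_mul' := fun a b ↦ by
        change equivShrink _ (a * b) = equivShrink _ ((equivShrink _).symm (equivShrink _ a) *
          (equivShrink _).symm (equivShrink _ b))
        simp }

section Fiber

variable {p : ℕ} {R : Type} [CommRing R] [Algebra R (ℤ × ℤ)]

/-- The `R`-submodule of `ℤ × ℤ` of pairs `(a, b)` with `b ≡ u * a` modulo `p`, when `R` acts
through pairs with congruent entries. -/
def twistedDiagonal (h : ∀ r : R, ((algebraMap R (ℤ × ℤ) r).1 : ZMod p) =
    (algebraMap R (ℤ × ℤ) r).2) (u : ZMod p) : Submodule R (ℤ × ℤ) where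
  carrier := {z | (z.2 : ZMod p) = u * z.1}
  zero_mem' := by simp
  add_mem' {a b} ha hb := by
    simp only [Set.mem_ofPred_eq, Prod.fst_add, Prod.snd_add, Int.cast_add] at *
    rw [ha, hb, mul_add]
  smul_mem' r z hz := by
    simp only [Set.mem_ofPred_eq, Algebra.smul_def, Prod.fst_mul, Prod.snd_mul,
      Int.cast_mul] at *
    rw [hz, h]
    ring

variable (h : ∀ r : R, ((algebraMap R (ℤ × ℤ) r).1 : ZMod p) = (algebraMap R (ℤ × ℤ) r).2)

@[simp]
theorem mem_twistedDiagonal {u : ZMod p} {z : ℤ × ℤ} :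
    z ∈ twistedDiagonal h u ↔ (z.2 : ZMod p) = u * z.1 :=
  Iff.rfl

theorem twistedDiagonal_mul (u v : (ZMod p)ˣ) :
    twistedDiagonal h (u * v : (ZMod p)ˣ) = twistedDiagonal h u * twistedDiagonal h v := by
  refine le_antisymm (fun z hz ↦ ?_) (Submodule.mul_le.mpr fun x hx y hy ↦ ?_)
  · obtain ⟨a, ha⟩ := ZMod.intCast_surjective (u : ZMod p)
    obtain ⟨b, hb⟩ := ZMod.intCast_surjective (v : ZMod p)
    obtain ⟨c, hc⟩ := ZMod.intCast_surjective ((v⁻¹ : (ZMod p)ˣ) : ZMod p)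
    rw [mem_twistedDiagonal, Units.val_mul] at hz
    have key : z = (z.1, z.1 * a) * (1, b) + (0, z.2 - z.1 * a * b) * (c, 1) := by
      ext <;> simp
    rw [key]
    refine add_mem (Submodule.mul_mem_mul ?_ ?_) (Submodule.mul_mem_mul ?_ ?_)
    · simp [ha, mul_comm]
    · simp [hb]
    · simp only [mem_twistedDiagonal, Int.cast_sub, Int.cast_mul, hz, ha, hb, Int.cast_zero]
      ring
    · simp [hc]
  · simp only [mem_twistedDiagonal, Prod.fst_mul, Prod.snd_mul, Int.cast_mul,
      Units.val_mul] at *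
    rw [hx, hy]
    ring

theorem twistedDiagonal_one
    (hsurj : ∀ z : ℤ × ℤ, (z.1 : ZMod p) = z.2 → ∃ r : R, algebraMap R (ℤ × ℤ) r = z) :
    twistedDiagonal h 1 = 1 := by
  ext z
  rw [mem_twistedDiagonal, one_mul, Submodule.mem_one]
  exact ⟨fun hz ↦ hsurj z hz.symm, fun ⟨r, hr⟩ ↦ hr ▸ (h r).symm⟩

variable (hsurj : ∀ z : ℤ × ℤ, (z.1 : ZMod p) = z.2 → ∃ r : R, algebraMap R (ℤ × ℤ) r = z)

/-- Twisted diagonals as invertible submodules of `ℤ × ℤ`. -/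
noncomputable def twistedDiagonalHom : (ZMod p)ˣ →* (Submodule R (ℤ × ℤ))ˣ :=
  MonoidHom.toHomUnits
    { toFun := fun u ↦ twistedDiagonal h u
      map_one' := twistedDiagonal_one h hsurj
      map_mul' := twistedDiagonal_mul h }

@[simp]
theorem coe_twistedDiagonalHom (u : (ZMod p)ˣ) :
    (twistedDiagonalHom h hsurj u : Submodule R (ℤ × ℤ)) = twistedDiagonal h u :=
  rfl

theorem twistedDiagonalHom_surjective [Fact p.Prime] :
    Function.Surjective (twistedDiagonalHom h hsurj) := by
  intro I
  have hmul {x y : ℤ × ℤ} (hx : x ∈ I.val) (hy : y ∈ I.inv) :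
      (x.2 : ZMod p) * y.2 = x.1 * y.1 := by
    have : x * y ∈ twistedDiagonal h 1 := by
      rw [twistedDiagonal_one h hsurj, ← I.val_inv]
      exact Submodule.mul_mem_mul hx hy
    simpa using this
  obtain ⟨x, hx, y, hy, hxy⟩ : ∃ x ∈ I.val, ∃ y ∈ I.inv, (x.1 : ZMod p) * y.1 ≠ 0 := by
    by_contra! H
    have hone : (1 : ℤ × ℤ) ∈ I.val * I.inv := I.val_inv ▸ Submodule.one_le.mp le_rfl
    have hzero : (((1 : ℤ × ℤ).1 : ℤ) : ZMod p) = 0 := by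
      refine Submodule.mul_induction_on (C := fun z : ℤ × ℤ ↦ (z.1 : ZMod p) = 0) hone
        (fun x hx y hy ↦ ?_) fun x y hx hy ↦ ?_
      · simpa using H x hx y hy
      · simp [hx, hy]
    simp at hzero
  have hy1 : (y.1 : ZMod p) ≠ 0 := right_ne_zero_of_mul hxy
  have hy2 : (y.2 : ZMod p) ≠ 0 := right_ne_zero_of_mul (hmul hx hy ▸ hxy)
  let u : (ZMod p)ˣ := Units.mk0 _ hy1 / Units.mk0 _ hy2
  have hI : I.val ≤ twistedDiagonal h u := fun z hz ↦ by
    rw [mem_twistedDiagonal, Units.val_div_eq_div_val, Units.val_mk0, Units.val_mk0,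
      div_mul_eq_mul_div, eq_div_iff hy2, hmul hz hy, mul_comm]
  have hI' : I.inv ≤ twistedDiagonal h (u⁻¹ : (ZMod p)ˣ) := fun w hw ↦ by
    have hx2 : (x.2 : ZMod p) ≠ 0 := left_ne_zero_of_mul (hmul hx hy ▸ hxy)
    rw [mem_twistedDiagonal, inv_div, Units.val_div_eq_div_val, Units.val_mk0, Units.val_mk0,
      div_mul_eq_mul_div, eq_div_iff hy1]
    refine mul_left_cancel₀ hx2 ?_
    linear_combination (y.1 : ZMod p) * hmul hx hw - (w.1 : ZMod p) * hmul hx hy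
  refine ⟨u, Units.ext (le_antisymm ?_ hI)⟩
  calc twistedDiagonal h u = twistedDiagonal h u * (I.inv * I.val) := by rw [I.inv_val, mul_one]
    _ ≤ twistedDiagonal h u * (twistedDiagonal h (u⁻¹ : (ZMod p)ˣ) * I.val) :=
      mul_le_mul' le_rfl (mul_le_mul' hI' le_rfl)
    _ = I.val := by
      rw [← mul_assoc, ← twistedDiagonal_mul, mul_inv_cancel, Units.val_one,
        twistedDiagonal_one h hsurj, one_mul]

variable [FaithfulSMul R (ℤ × ℤ)]

theorem ker_unitsToPic_comp_twistedDiagonalHom :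
    ((Submodule.unitsToPic R (ℤ × ℤ)).comp (twistedDiagonalHom h hsurj)).ker =
      Subgroup.closure {-1} := by
  refine le_antisymm (fun u hu ↦ ?_) ((Subgroup.closure_le _).mpr ?_)
  · have hu' : twistedDiagonalHom h hsurj u ∈ (Submodule.unitsToPic R (ℤ × ℤ)).ker := hu
    rw [Submodule.ker_unitsToPic] at hu'
    obtain ⟨x, hx⟩ := hu'
    have hmem : (x : ℤ × ℤ) ∈ twistedDiagonal h u := by
      rw [← coe_twistedDiagonalHom h hsurj, ← hx]
      exact Submodule.mem_span_singleton_self _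
    rw [mem_twistedDiagonal] at hmem
    obtain ⟨h1, h2⟩ := Prod.isUnit_iff.mp x.isUnit
    have hpm : u = 1 ∨ u = -1 := by
      rcases Int.isUnit_iff.mp h1 with e1 | e1 <;> rcases Int.isUnit_iff.mp h2 with e2 | e2 <;>
        rw [e1, e2] at hmem
      · exact .inl (Units.ext (by simpa using hmem.symm))
      · exact .inr (Units.ext (by simpa using hmem.symm))
      · exact .inr (Units.ext (by simpa [eq_neg_iff_add_eq_zero, add_comm] using hmem))
      · exact .inl (Units.ext (by simpa using hmem.symm))
    rcases hpm with rfl | rfl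
    · exact one_mem _
    · exact Subgroup.mem_closure_singleton_self _
  · rw [Set.singleton_subset_iff]
    change twistedDiagonalHom h hsurj (-1) ∈ (Submodule.unitsToPic R (ℤ × ℤ)).ker
    rw [Submodule.ker_unitsToPic]
    refine ⟨MulEquiv.prodUnits.symm (1, -1), Units.ext ?_⟩
    change Submodule.span R {((1, -1) : ℤ × ℤ)} = twistedDiagonal h ((-1 : (ZMod p)ˣ) : ZMod p)
    refine le_antisymm ((Submodule.span_singleton_le_iff_mem _ _).mpr (by simp)) fun z hz ↦ ?_
    obtain ⟨r, hr⟩ := hsurj (z.1, -z.2) (by simpa [eq_neg_iff_add_eq_zero, add_comm] using hz)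
    refine Submodule.mem_span_singleton.mpr ⟨r, ?_⟩
    rw [Algebra.smul_def, hr]
    ext <;> simp

end Fiber

/-- If `R` is the subring of `ℤ × ℤ` of pairs with entries congruent modulo a prime `p`, then its
Picard group is `(ℤ/pℤ)ˣ / {±1}`. -/
theorem nonempty_pic_mulEquiv_of_algebra_int_prod_int {p : ℕ} [Fact p.Prime] {R : Type}
    [CommRing R] [Algebra R (ℤ × ℤ)] [FaithfulSMul R (ℤ × ℤ)]
    (h : ∀ r : R, ((algebraMap R (ℤ × ℤ) r).1 : ZMod p) = (algebraMap R (ℤ × ℤ) r).2)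
    (hsurj : ∀ z : ℤ × ℤ, (z.1 : ZMod p) = z.2 → ∃ r : R, algebraMap R (ℤ × ℤ) r = z) :
    Nonempty (CommRing.Pic R ≃* (ZMod p)ˣ ⧸ Subgroup.closure {(-1 : (ZMod p)ˣ)}) := by
  have := CommRing.Pic.subsingleton_of_isPrincipalIdealRing (ℤ × ℤ)
  have hs : Function.Surjective (Submodule.unitsToPic R (ℤ × ℤ)) := by
    rw [← MonoidHom.range_eq_top, Submodule.range_unitsToPic, CommRing.relPic_eq_top]
  exact ⟨((QuotientGroup.quotientMulEquivOfEq
    (ker_unitsToPic_comp_twistedDiagonalHom h hsurj).symm).trans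
    (QuotientGroup.quotientKerEquivOfSurjective _
      (hs.comp (twistedDiagonalHom_surjective h hsurj)))).symm⟩

/-- The ring map `ℤ[X] → ℤ × ℤ` sending `X` to `(0, p)`. -/
noncomputable def evalZeroPrime (p : ℕ) : ℤ[X] →+* ℤ × ℤ :=
  (evalRingHom 0).prod (evalRingHom (p : ℤ))

theorem evalZeroPrime_apply (p : ℕ) (f : ℤ[X]) :
    evalZeroPrime p f = (f.eval 0, f.eval (p : ℤ)) :=
  rfl

theorem ker_evalZeroPrime {p : ℕ} (hp : p ≠ 0) :
    RingHom.ker (evalZeroPrime p) = Ideal.span {(X : ℤ[X]) ^ 2 - (p : ℤ[X]) * X} := by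
  ext f
  rw [RingHom.mem_ker, Ideal.mem_span_singleton, evalZeroPrime_apply, Prod.mk_eq_zero]
  constructor
  · rintro ⟨h0, h1⟩
    obtain ⟨g, rfl⟩ := X_dvd_iff.mpr (coeff_zero_eq_eval_zero f ▸ h0)
    rw [eval_mul, eval_X, mul_eq_zero, or_iff_right (by exact_mod_cast hp)] at h1
    obtain ⟨k, rfl⟩ := dvd_iff_isRoot.mpr h1
    exact ⟨k, by simp; ring⟩
  · rintro ⟨g, rfl⟩
    constructor
    · simp
    · simp [pow_two]

/-- The mark homomorphism of the Burnside ring of `ℤ/p`. -/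
noncomputable def markHom {p : ℕ} (hp : p ≠ 0) : BurnsideRingModel p →+* ℤ × ℤ :=
  Ideal.Quotient.lift _ (evalZeroPrime p) fun f hf ↦ by rwa [← ker_evalZeroPrime hp] at hf

theorem markHom_mk {p : ℕ} (hp : p ≠ 0) (f : ℤ[X]) :
    markHom hp (Ideal.Quotient.mk _ f) = (f.eval 0, f.eval (p : ℤ)) :=
  rfl

theorem markHom_injective {p : ℕ} (hp : p ≠ 0) : Function.Injective (markHom hp) :=
  RingHom.lift_injective_of_ker_le_ideal _ _ (ker_evalZeroPrime hp).le

theorem markHom_congr {p : ℕ} (hp : p ≠ 0) (r : BurnsideRingModel p) :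
    ((markHom hp r).1 : ZMod p) = (markHom hp r).2 := by
  obtain ⟨f, rfl⟩ := Ideal.Quotient.mk_surjective r
  rw [ZMod.intCast_eq_intCast_iff_dvd_sub, markHom_mk]
  simpa using f.sub_dvd_eval_sub (p : ℤ) 0

theorem exists_markHom_eq {p : ℕ} (hp : p ≠ 0) (z : ℤ × ℤ) (hz : (z.1 : ZMod p) = z.2) :
    ∃ r, markHom hp r = z := by
  obtain ⟨k, hk⟩ := (ZMod.intCast_eq_intCast_iff_dvd_sub _ _ _).mp hz
  refine ⟨Ideal.Quotient.mk _ (C z.1 + C k * X), ?_⟩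
  rw [markHom_mk]
  ext
  · simp
  · simp only [eval_add, eval_mul, eval_C, eval_X]
    linarith

/-- For every prime `p`, the Picard group of `ℤ[X]/(X² − pX)` (the Burnside ring of
`ℤ/p`) is isomorphic to `(ℤ/pℤ)ˣ / {±1}`. -/
theorem stmt13 (p : ℕ) (hp : p.Prime) :
    Nonempty (PicardGroup (BurnsideRingModel p) ≃*
      (ZMod p)ˣ ⧸ Subgroup.closure {(-1 : (ZMod p)ˣ)}) := by
  have : Fact p.Prime := ⟨hp⟩
  let _ : Algebra (BurnsideRingModel p) (ℤ × ℤ) := (markHom hp.ne_zero).toAlgebra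
  have : FaithfulSMul (BurnsideRingModel p) (ℤ × ℤ) :=
    (faithfulSMul_iff_algebraMap_injective _ _).mpr (markHom_injective hp.ne_zero)
  obtain ⟨e⟩ := nonempty_pic_mulEquiv_of_algebra_int_prod_int (R := BurnsideRingModel p)
    (markHom_congr hp.ne_zero) (exists_markHom_eq hp.ne_zero)
  exact ⟨(picardGroupEquivPic _).trans e⟩
end
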